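/- arXiv:2307.05732 — 2 statements merged into one kernel-verified Lean document; each statement's English description precedes it below -/
import Mathlib

section
/- Let d ≥ 1, let k = (k_1, …, k_d) be non-negative integers, and let f : ℝ^d → ℝ be such that for every j ∈ {1,…,d} and every x ∈ ℝ^d the univariate map t ↦ f(x + t e_j) is k_j-times differentiable, with k_j-th derivative f_{j,x}(t) := (d^{k_j}/dt^{k_j}) f(x + t e_j). Suppose that for each j there is a constant L_j > 0 with |f_{j,x}(t) − f_{j,x}(0)| ≤ L_j |t| for all x ∈ ℝ^d and t ∈ ℝ. Then for any reals α_1, …, α_d with α_j ≥ L_j for all j, the function g_α(x) := f(x) + Σ_{i=1}^d (α_i/(k_i+1)!) x_i^(k_i+1) is coordinate-wise (k+1)-monotone, i.e., for each j ∈ {1,…,d} and each x ∈ ℝ^d, the map t ↦ (d^{k_j}/dt^{k_j}) g_α(x + t e_j) is non-decreasing in t ∈ ℝ. Consequently f(x) = g_α(x) − Σ_{i=1}^d (α_i/(k_i+1)!) x_i^(k_i+1). -/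
lemma aux_iter (F : ℝ → ℝ) (a c C : ℝ) (k : ℕ) : ∀ n ≤ k,
    (∀ i < n, Differentiable ℝ (iteratedDeriv i F)) →
    ∃ C' : ℝ, iteratedDeriv n
      (fun t => F t + (C + a / (Nat.factorial (k + 1) : ℝ) * (c + t) ^ (k + 1))) =
      fun t => iteratedDeriv n F t +
        (C' + a / (Nat.factorial (k - n + 1) : ℝ) * (c + t) ^ (k - n + 1)) := by
  intro n
  induction n with
  | zero => intro _ _; exact ⟨C, by simp⟩
  | succ n ih =>
    intro hn hF
    obtain ⟨C', h⟩ := ih (by omega) (fun i hi => hF i (by omega))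
    refine ⟨0, ?_⟩
    rw [iteratedDeriv_succ, h]
    funext t
    obtain ⟨m, hm⟩ : ∃ m, k - n = m + 1 := ⟨k - n - 1, by omega⟩
    have hm' : k - (n + 1) = m := by omega
    rw [hm, hm', iteratedDeriv_succ]
    have h1 := (hF n (by omega) t).hasDerivAt
    have h2 : HasDerivAt (fun t : ℝ => (c + t) ^ (m + 1 + 1))
        (((m + 1 + 1 : ℕ) : ℝ) * (c + t) ^ (m + 1) * 1) t := by
      exact ((hasDerivAt_id t).const_add c).pow (m + 1 + 1)
    have h3 := h1.add ((h2.const_mul (a / (Nat.factorial (m + 1 + 1) : ℝ))).const_add C')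
    refine h3.deriv.trans ?_
    have hf : ((m + 1).factorial : ℝ) ≠ 0 := by positivity
    have hp : ((m + 1 + 1 : ℕ) : ℝ) ≠ 0 := by positivity
    rw [Nat.factorial_succ (m + 1), Nat.cast_mul]
    field_simp
    ring

/-- coordinate-wise Lipschitz `k_j`-th derivatives. If for each coordinate `j` and
each base point `x`, the univariate section `t ↦ f (x + t e_j)` is `k_j`-times differentiable and
its `k_j`-th derivative `f_{j,x}` satisfies `|f_{j,x} t - f_{j,x} 0| ≤ L_j |t|`, then for any
`α_j ≥ L_j` the function `g_α x = f x + ∑ i (α_i/(k_i+1)!) x_i^(k_i+1)` is coordinate-wise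
`(k+1)`-monotone, and `f x = g_α x - ∑ i (α_i/(k_i+1)!) x_i^(k_i+1)`. -/
theorem coordinatewise_k_monotone_decomposition (d : ℕ) (hd : 1 ≤ d)
    (k : Fin d → ℕ) (f : (Fin d → ℝ) → ℝ) (L : Fin d → ℝ) (hL : ∀ j, 0 < L j)
    (hdiff : ∀ (j : Fin d) (x : Fin d → ℝ), ∀ i < k j,
      Differentiable ℝ (iteratedDeriv i (fun t : ℝ => f (x + t • (Pi.single j 1 : Fin d → ℝ)))))
    (hlip : ∀ (j : Fin d) (x : Fin d → ℝ) (t : ℝ),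
      |iteratedDeriv (k j) (fun s : ℝ => f (x + s • (Pi.single j 1 : Fin d → ℝ))) t -
        iteratedDeriv (k j) (fun s : ℝ => f (x + s • (Pi.single j 1 : Fin d → ℝ))) 0| ≤ L j * |t|)
    (α : Fin d → ℝ) (hα : ∀ j, L j ≤ α j) :
    (∀ (j : Fin d) (x : Fin d → ℝ),
      Monotone (iteratedDeriv (k j) (fun t : ℝ =>
        (fun z : Fin d → ℝ =>
            f z + ∑ i, (α i / (Nat.factorial (k i + 1) : ℝ)) * (z i) ^ (k i + 1))
          (x + t • (Pi.single j 1 : Fin d → ℝ))))) ∧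
    ∀ x : Fin d → ℝ, f x =
      (f x + ∑ i, (α i / (Nat.factorial (k i + 1) : ℝ)) * (x i) ^ (k i + 1))
        - ∑ i, (α i / (Nat.factorial (k i + 1) : ℝ)) * (x i) ^ (k i + 1) := by
  classical
  refine ⟨fun j x => ?_, fun x => by ring⟩
  set F : ℝ → ℝ := fun t : ℝ => f (x + t • (Pi.single j 1 : Fin d → ℝ)) with hF
  obtain ⟨C', h⟩ := aux_iter F (α j) (x j)
    (∑ i ∈ Finset.univ.erase j, (α i / (Nat.factorial (k i + 1) : ℝ)) * (x i) ^ (k i + 1))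
    (k j) (k j) le_rfl (hdiff j x)
  have hfun : (fun t : ℝ =>
        (fun z : Fin d → ℝ =>
            f z + ∑ i, (α i / (Nat.factorial (k i + 1) : ℝ)) * (z i) ^ (k i + 1))
          (x + t • (Pi.single j 1 : Fin d → ℝ))) = fun t => F t +
      ((∑ i ∈ Finset.univ.erase j, (α i / (Nat.factorial (k i + 1) : ℝ)) * (x i) ^ (k i + 1))
        + α j / (Nat.factorial (k j + 1) : ℝ) * (x j + t) ^ (k j + 1)) := by
    funext t
    simp only [hF]
    congr 1
    rw [← Finset.sum_erase_add _ _ (Finset.mem_univ j)]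
    congr 1
    · refine Finset.sum_congr rfl fun i hi => ?_
      simp [Pi.single_eq_of_ne (Finset.ne_of_mem_erase hi)]
    · simp
  rw [hfun, h]
  intro s t hst
  have key := hlip j (x + s • (Pi.single j 1 : Fin d → ℝ)) (t - s)
  have hsh : (fun u : ℝ => f (x + s • (Pi.single j 1 : Fin d → ℝ) +
      u • (Pi.single j 1 : Fin d → ℝ))) = fun u => F (u + s) := by
    funext u
    simp only [hF]
    congr 1
    rw [add_smul]
    abel
  rw [hsh, iteratedDeriv_comp_add_const] at key
  simp only [sub_add_cancel, zero_add, abs_of_nonneg (sub_nonneg.2 hst)] at key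
  have h1 := (abs_le.1 key).1
  have h2 := mul_le_mul_of_nonneg_right (hα j) (sub_nonneg.2 hst)
  simp only [Nat.sub_self, zero_add, Nat.factorial_one, Nat.cast_one, div_one, pow_one]
  linarith
end

section
/- For any finite set of observations (x_1, y_1), …, (x_n, y_n) ∈ ℝ × ℝ with distinct covariates x_1, …, x_n, there exist a constant α > 0 and a non-decreasing function g : ℝ → ℝ such that g(x_i) − α x_i = y_i for every i ∈ {1,…,n}. In other words, the function class {x ↦ g(x) − α x : α > 0, g non-decreasing} can interpolate any finite data set with distinct covariates, achieving zero squared error Σ_{i=1}^n (y_i − (g(x_i) − α x_i))² = 0. -/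
/-- the class `{x ↦ g x - α x : α > 0, g non-decreasing}` interpolates any finite
data set with pairwise distinct covariates, achieving zero squared error. -/
theorem monotone_plus_linear_interpolation (n : ℕ) (x y : Fin n → ℝ)
    (hx : Function.Injective x) :
    ∃ α : ℝ, 0 < α ∧ ∃ g : ℝ → ℝ, Monotone g ∧
      (∀ i, g (x i) - α * x i = y i) ∧
      ∑ i, (y i - (g (x i) - α * x i)) ^ 2 = 0 := by
  set q : Fin n × Fin n → ℝ := fun p => |(y p.1 - y p.2) / (x p.1 - x p.2)| with hq
  have hq0 : ∀ p, 0 ≤ q p := fun p => abs_nonneg _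
  obtain ⟨α, hα⟩ : ∃ α, α = 1 + ∑ p, q p := ⟨_, rfl⟩
  have hS : 0 ≤ ∑ p, q p := Finset.sum_nonneg fun p _ => hq0 p
  have hle : ∀ i j, |(y i - y j) / (x i - x j)| ≤ α := fun i j => by
    have := Finset.single_le_sum (f := q) (fun p _ => hq0 p) (Finset.mem_univ (i, j))
    simp only [hq] at this hα
    linarith
  let f : ℝ → ℝ := Function.extend x (fun i => y i + α * x i) 0
  have hf : ∀ i, f (x i) = y i + α * x i := fun i => hx.extend_apply _ _ i
  have hmono : MonotoneOn f (Set.range x) := by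
    rintro _ ⟨i, rfl⟩ _ ⟨j, rfl⟩ hij
    rw [hf, hf]
    rcases hij.eq_or_lt with h | h
    · rw [hx h]
    · have h1 := (abs_le.1 (hle j i)).1
      rw [le_div_iff₀ (by linarith)] at h1
      linarith
  have hfin : (f '' Set.range x).Finite := (Set.finite_range x).image f
  obtain ⟨g, hg, hfg⟩ := hmono.exists_monotone_extension hfin.bddBelow hfin.bddAbove
  have key : ∀ i, g (x i) - α * x i = y i := fun i => by
    rw [← hfg ⟨i, rfl⟩, hf]; ring
  exact ⟨α, by linarith, g, hg, key, by simp [key]⟩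
end
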